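/- Let B be a block of the dual graph of an RNA secondary structure that represents a pseudoknot (B contains a vertex of degree at least 3). If B has edge-connectivity exactly 2 — i.e., B is connected, remains connected after deleting any single edge, but there exist two edges whose deletion disconnects B — then the pseudoknot represented by B is recursive: the pseudoknot M_{i,j} occupying region [i,j] contains a pseudoknotted or regular region M_{k,l} with i < k < l < j such that there is no base pair (c,d) with d a position of M_{k,l} and c a position of M_{i,j} outside of M_{k,l}. -/

import Mathlib

/-! ## Multigraphs, subgraphs, blocks, degrees, connectivity -/

/-- A multigraph on vertex type `V` with edge type `E`: each edge is assigned an
unordered pair of endpoints. -/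
structure Multigraph (V E : Type) where
  ends : E → Sym2 V

namespace Multigraph

variable {V E : Type}

/-- The degree of a vertex `u`: the number of edges incident at `u`. -/
noncomputable def degree (G : Multigraph V E) (u : V) : ℕ :=
  Set.ncard {e | u ∈ G.ends e}

/-- A subgraph of a multigraph: a set of vertices together with a set of edges
all of whose endpoints lie in the vertex set. -/
structure Subgraph (G : Multigraph V E) where
  verts : Set V
  edges : Set E
  ends_mem : ∀ e ∈ edges, ∀ v, v ∈ G.ends e → v ∈ verts

namespace Subgraph

variable {G : Multigraph V E}

/-- The degree of a vertex `u` in a subgraph `H`: the number of edges of `H`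
incident at `u`. -/
noncomputable def degree (H : G.Subgraph) (u : V) : ℕ :=
  Set.ncard {e ∈ H.edges | u ∈ G.ends e}

/-- One step along an edge of the subgraph `H`, avoiding the deleted edges `F`
and the deleted vertices `W`. -/
def Adj (H : G.Subgraph) (F : Set E) (W : Set V) (a b : V) : Prop :=
  a ∈ H.verts ∧ b ∈ H.verts ∧ a ∉ W ∧ b ∉ W ∧
    ∃ e ∈ H.edges, e ∉ F ∧ G.ends e = s(a, b)

/-- The subgraph `H` is connected after deleting the edges in `F` and the
vertices in `W`: any two remaining vertices are joined by a walk. -/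
def ConnectedAvoiding (H : G.Subgraph) (F : Set E) (W : Set V) : Prop :=
  ∀ u ∈ H.verts \ W, ∀ v ∈ H.verts \ W, Relation.ReflTransGen (H.Adj F W) u v

/-- The subgraph `H` is connected (and nonempty). -/
def Connected (H : G.Subgraph) : Prop :=
  H.verts.Nonempty ∧ H.ConnectedAvoiding ∅ ∅

/-- `w` is an articulation point of `H`: deleting `w` disconnects `H`. -/
def IsArticulation (H : G.Subgraph) (w : V) : Prop :=
  w ∈ H.verts ∧ ¬ H.ConnectedAvoiding ∅ {w}

/-- A block of `G`: a maximal connected subgraph without articulation points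
(maximal non-separable component). -/
def IsBlock (H : G.Subgraph) : Prop :=
  H.Connected ∧ (∀ w, ¬ H.IsArticulation w) ∧
    ∀ H' : G.Subgraph, H'.Connected → (∀ w, ¬ H'.IsArticulation w) →
      H.verts ⊆ H'.verts → H.edges ⊆ H'.edges →
      H.verts = H'.verts ∧ H.edges = H'.edges

/-- The subgraph `H` has edge-connectivity exactly `2`: it is connected, it
remains connected after deleting any single edge, but some two edges
disconnect it. -/
def EdgeConnTwo (H : G.Subgraph) : Prop :=
  H.Connected ∧ (∀ e : E, H.ConnectedAvoiding {e} ∅) ∧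
    ∃ e₁ ∈ H.edges, ∃ e₂ ∈ H.edges, e₁ ≠ e₂ ∧ ¬ H.ConnectedAvoiding {e₁, e₂} ∅

/-- `H` consists of a single edge together with its endpoints. -/
def IsSingleEdge (H : G.Subgraph) : Prop :=
  ∃ e, H.edges = {e} ∧ H.verts = {v | v ∈ G.ends e}

/-- `H` is a cycle: a connected graph in which every vertex has degree
exactly `2`. -/
def IsCycle (H : G.Subgraph) : Prop :=
  H.Connected ∧ ∀ v ∈ H.verts, H.degree v = 2

end Subgraph

end Multigraph

/-! ## RNA secondary structures, stems, segments and the dual (di)graph -/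

/-- An RNA secondary structure of length `n`: a set `pairs` of base pairs
`(i, j)` with `1 ≤ i < j ≤ n` in which every position occurs in at most one
base pair (a partial matching). -/
structure RNA (n : ℕ) where
  pairs : Finset (ℕ × ℕ)
  one_le : ∀ p ∈ pairs, 1 ≤ p.1
  fst_lt_snd : ∀ p ∈ pairs, p.1 < p.2
  le_length : ∀ p ∈ pairs, p.2 ≤ n
  matching : ∀ p ∈ pairs, ∀ q ∈ pairs, p ≠ q →
    p.1 ≠ q.1 ∧ p.1 ≠ q.2 ∧ p.2 ≠ q.1 ∧ p.2 ≠ q.2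

namespace RNA

variable {n : ℕ}

/-- Position `p` is paired (belongs to some base pair). -/
def Paired (R : RNA n) (p : ℕ) : Prop :=
  ∃ q, (p, q) ∈ R.pairs ∨ (q, p) ∈ R.pairs

/-- A stem of `R`: a maximal tuple of consecutively nested base pairs
`(i, j), (i+1, j-1), …, (i+r, j-r)` of `R`. -/
structure Stem (R : RNA n) where
  i : ℕ
  j : ℕ
  r : ℕ
  nested : ∀ k ≤ r, (i + k, j - k) ∈ R.pairs
  sep : i + r < j - r
  max_out : (i - 1, j + 1) ∉ R.pairs
  max_in : (i + r + 1, j - (r + 1)) ∉ R.pairs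

/-- Position `p` is occupied by the stem `S`. -/
def Stem.MemPos {R : RNA n} (S : Stem R) (p : ℕ) : Prop :=
  ∃ k ≤ S.r, p = S.i + k ∨ p = S.j - k

/-- `(a, b)` is one of the base pairs of the stem `S`. -/
def Stem.MemPair {R : RNA n} (S : Stem R) (a b : ℕ) : Prop :=
  ∃ k ≤ S.r, a = S.i + k ∧ b = S.j - k

/-- `S` is a super-stem of `T` (written `S > T` in the paper): the region
occupied by `T` is strictly contained inside the paired region of `S`. -/
def SuperStem {R : RNA n} (S T : Stem R) : Prop :=
  S.i + S.r < T.i ∧ T.j < S.j - S.r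

/-- A single-stranded segment running, 5' to 3', from the paired position `p`
to the next paired position `q`: all strictly intermediate positions are
unpaired. -/
def IsSegment (R : RNA n) (p q : ℕ) : Prop :=
  p < q ∧ R.Paired p ∧ R.Paired q ∧ ∀ t, p < t → t < q → ¬ R.Paired t

/-- An edge of the dual (di)graph of `R`: a single-stranded segment running
from an occurrence (position `p`) of stem `src` to an occurrence (position
`q`) of stem `tgt`, with self-loops (hairpins, `src = tgt`) deleted.  Read as
a directed edge it is directed from `src` to `tgt` (5' to 3'). -/
structure DualEdge (R : RNA n) where
  p : ℕ
  q : ℕ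
  src : Stem R
  tgt : Stem R
  seg : R.IsSegment p q
  mem_src : src.MemPos p
  mem_tgt : tgt.MemPos q
  ne : src ≠ tgt

/-- The dual graph of `R`: vertices are the stems of `R`, and each
single-stranded segment between occurrences of two distinct stems contributes
one edge between them. -/
def dualGraph (R : RNA n) : Multigraph (Stem R) (DualEdge R) :=
  ⟨fun e => s(e.src, e.tgt)⟩

/-- The weight of a directed edge of the dual digraph: the order (1st, 2nd, …)
in which the corresponding segment is reached along the primary sequence,
i.e. the number of segments starting no later than it. -/
noncomputable def DualEdge.weight {R : RNA n} (e : DualEdge R) : ℕ :=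
  Set.ncard {p' | ∃ q', R.IsSegment p' q' ∧ p' ≤ e.p}

end RNA

/-- The pseudoknot occupying the region `[i, j]` is recursive (Wong et al.):
it contains a pseudoknotted or regular region `[k, l]`, `i < k < l < j`
(a nonempty internal structure), such that there is no base pair `(c, d)`
with `d` a position of `[k, l]` and `c` a position of `[i, j]` external to
`[k, l]`. -/
def RNA.RecursivePK {n : ℕ} (R : RNA n) (i j : ℕ) : Prop :=
  ∃ k l : ℕ, i < k ∧ k < l ∧ l < j ∧
    (∃ a b : ℕ, (a, b) ∈ R.pairs ∧ k ≤ a ∧ b ≤ l) ∧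
    ∀ c d : ℕ, ((c, d) ∈ R.pairs ∨ (d, c) ∈ R.pairs) →
      k ≤ d → d ≤ l → i ≤ c → c ≤ j → k ≤ c ∧ c ≤ l

namespace RNA

variable {n : ℕ}

theorem pair_unique (R : RNA n) {a b c d : ℕ} (h : (a, b) ∈ R.pairs) (h' : (c, d) ∈ R.pairs)
    (hx : a = c ∨ a = d ∨ b = c ∨ b = d) : a = c ∧ b = d := by
  by_contra hne
  have := R.matching _ h _ h' (by intro e; apply hne; simpa using e)
  simp only at this
  omega

theorem Stem.lt {R : RNA n} (S : Stem R) {k : ℕ} (hk : k ≤ S.r) : S.i + k < S.j - k :=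
  R.fst_lt_snd _ (S.nested k hk)

theorem stem_eq_aux {R : RNA n} (S T : Stem R) {k k' : ℕ} (hk : k ≤ S.r) (hk' : k' ≤ T.r)
    (h1 : S.i + k = T.i + k') (h2 : S.j - k = T.j - k') : ¬ k < k' := by
  intro hlt
  have h := T.nested (k' - k - 1) (by omega)
  have a1 := S.lt hk
  have a2 := T.lt hk'
  have b1 := S.max_out
  have e1 : T.i + (k' - k - 1) = S.i - 1 := by omega
  have e2 : T.j - (k' - k - 1) = S.j + 1 := by omega
  rw [e1, e2] at h
  exact b1 h

theorem stem_eq_aux2 {R : RNA n} (S T : Stem R)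
    (h1 : S.i = T.i) (h2 : S.j = T.j) : ¬ S.r < T.r := by
  intro hlt
  have h := T.nested (S.r + 1) (by omega)
  rw [← h1, ← h2] at h
  exact S.max_in h

theorem stem_unique {R : RNA n} {S T : Stem R} {p : ℕ} (hS : S.MemPos p) (hT : T.MemPos p) :
    S = T := by
  obtain ⟨k, hk, h⟩ := hS
  obtain ⟨k', hk', h'⟩ := hT
  have := R.pair_unique (S.nested k hk) (T.nested k' hk') (by omega)
  have hkk : k = k' := by
    have := stem_eq_aux S T hk hk' this.1 this.2
    have := stem_eq_aux T S hk' hk (by omega) (by omega)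
    omega
  subst hkk
  have a1 := S.lt hk
  have a2 := T.lt hk'
  have hi : S.i = T.i := by omega
  have hj : S.j = T.j := by omega
  have hr : S.r = T.r := by
    have := stem_eq_aux2 S T hi hj
    have := stem_eq_aux2 T S hi.symm hj.symm
    omega
  cases S; cases T; simp at hi hj hr; subst hi hj hr; rfl

theorem exists_stem_pair (R : RNA n) {a b : ℕ} (h : (a, b) ∈ R.pairs) :
    ∃ S : Stem R, S.MemPos a ∧ S.MemPos b := by
  classical
  have hab := R.fst_lt_snd _ h
  have ex1 : ∃ m, (a - m, b + m) ∉ R.pairs := ⟨a, fun h => by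
    have := R.one_le _ h; simp at this⟩
  have ex2 : ∃ m, (a + m, b - m) ∉ R.pairs := ⟨b, fun h => by
    have := R.fst_lt_snd _ h; simp at this⟩
  obtain ⟨m, hm, hm'⟩ : ∃ m, (a - m, b + m) ∉ R.pairs ∧ ∀ t < m, (a - t, b + t) ∈ R.pairs :=
    ⟨Nat.find ex1, Nat.find_spec ex1, fun t ht => by simpa using Nat.find_min ex1 ht⟩
  obtain ⟨m', hn, hn'⟩ : ∃ m, (a + m, b - m) ∉ R.pairs ∧ ∀ t < m, (a + t, b - t) ∈ R.pairs :=
    ⟨Nat.find ex2, Nat.find_spec ex2, fun t ht => by simpa using Nat.find_min ex2 ht⟩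
  have m0 : 0 < m := by
    rcases Nat.eq_zero_or_pos m with h0 | h0
    · subst h0; exact absurd h hm
    · exact h0
  have m0' : 0 < m' := by
    rcases Nat.eq_zero_or_pos m' with h0 | h0
    · subst h0; exact absurd h hn
    · exact h0
  have q1 := R.one_le _ (hm' (m - 1) (by omega))
  have q2 := R.fst_lt_snd _ (hn' (m' - 1) (by omega))
  simp only at q1 q2
  refine ⟨⟨a - (m - 1), b + (m - 1), (m - 1) + (m' - 1), ?_, by omega, ?_, ?_⟩, ?_, ?_⟩
  · intro k hk
    rcases le_total k (m - 1) with hkm | hkm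
    · have := hm' (m - 1 - k) (by omega)
      convert this using 2 <;> omega
    · have := hn' (k - (m - 1)) (by omega)
      convert this using 2 <;> omega
  · convert hm using 3 <;> omega
  · convert hn using 3 <;> omega
  · exact ⟨m - 1, by simp, Or.inl (by simp only; omega)⟩
  · exact ⟨m - 1, by simp, Or.inr (by simp only; omega)⟩

theorem exists_stem (R : RNA n) {p : ℕ} (h : R.Paired p) : ∃ S : Stem R, S.MemPos p := by
  obtain ⟨q, h | h⟩ := h
  · obtain ⟨S, h, -⟩ := R.exists_stem_pair h; exact ⟨S, h⟩
  · obtain ⟨S, -, h⟩ := R.exists_stem_pair h; exact ⟨S, h⟩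

theorem Stem.MemPos.paired {R : RNA n} {S : Stem R} {p : ℕ} (h : S.MemPos p) : R.Paired p := by
  obtain ⟨k, hk, h | h⟩ := h
  · exact ⟨_, Or.inl (h ▸ S.nested k hk)⟩
  · exact ⟨_, Or.inr (h ▸ S.nested k hk)⟩

/-- adjacency in the dual graph -/
def GA (R : RNA n) (S T : Stem R) : Prop := ∃ e : DualEdge R, R.dualGraph.ends e = s(S, T)

theorem GA.symm {R : RNA n} {S T : Stem R} (h : GA R S T) : GA R T S := by
  obtain ⟨e, h⟩ := h
  exact ⟨e, by rw [h, Sym2.eq_swap]⟩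

/-- induced subgraph -/
def ind (R : RNA n) (U : Set (Stem R)) : Multigraph.Subgraph R.dualGraph where
  verts := U
  edges := {e | ∀ v, v ∈ R.dualGraph.ends e → v ∈ U}
  ends_mem := fun _ he => he

theorem ind_adj {R : RNA n} {U W : Set (Stem R)} {a b : Stem R} (ha : a ∈ U) (hb : b ∈ U)
    (ha' : a ∉ W) (hb' : b ∉ W) (h : GA R a b) : (ind R U).Adj ∅ W a b := by
  obtain ⟨e, he⟩ := h
  refine ⟨ha, hb, ha', hb', e, ?_, by simp, he⟩
  intro v hv
  rw [he] at hv
  rcases Sym2.mem_iff.1 hv with h | h <;> subst h <;> assumption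

theorem adj_ind {R : RNA n} {U W : Set (Stem R)} {B : Multigraph.Subgraph R.dualGraph}
    (hU : B.verts ⊆ U) {a b : Stem R} (h : B.Adj ∅ W a b) : (ind R U).Adj ∅ W a b := by
  obtain ⟨h1, h2, h3, h4, e, he, -, hh⟩ := h
  exact ind_adj (hU h1) (hU h2) h3 h4 ⟨e, hh⟩

theorem adj_symm {R : RNA n} {B : Multigraph.Subgraph R.dualGraph} {F W} :
    Symmetric (B.Adj F W) := by
  rintro a b ⟨h1, h2, h3, h4, e, he, hF, hh⟩
  exact ⟨h2, h1, h4, h3, e, he, hF, by rw [hh, Sym2.eq_swap]⟩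

theorem rtg_symm {α : Type*} {r : α → α → Prop} (hr : Symmetric r) {a b : α}
    (h : Relation.ReflTransGen r a b) : Relation.ReflTransGen r b a := by
  induction h with
  | refl => exact .refl
  | tail _ h ih => exact .head (hr h) ih

theorem rtg_mono {α : Type*} {r q : α → α → Prop} (hr : ∀ a b, r a b → q a b) {a b : α}
    (h : Relation.ReflTransGen r a b) : Relation.ReflTransGen q a b := by
  induction h with
  | refl => exact .refl
  | tail _ h ih => exact ih.tail (hr _ _ h)

theorem block_conn {R : RNA n} {B : Multigraph.Subgraph R.dualGraph} (hB : B.IsBlock)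
    (W : Set (Stem R)) (hW : W.Subsingleton) : B.ConnectedAvoiding ∅ W := by
  rcases hW.eq_empty_or_singleton with rfl | ⟨z, rfl⟩
  · exact hB.1.2
  · by_cases hz : z ∈ B.verts
    · by_contra h
      exact hB.2.1 z ⟨hz, h⟩
    · intro u hu v hv
      refine rtg_mono ?_ (hB.1.2 u ⟨hu.1, by simp⟩ v ⟨hv.1, by simp⟩)
      rintro a b ⟨h1, h2, h3, h4, h5⟩
      exact ⟨h1, h2, fun h => hz (h ▸ h1), fun h => hz (h ▸ h2), h5⟩

theorem block_max {R : RNA n} {B : Multigraph.Subgraph R.dualGraph} (hB : B.IsBlock)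
    (U : Set (Stem R)) (hU : B.verts ⊆ U)
    (h : ∀ W : Set (Stem R), W.Subsingleton → ∀ u ∈ U \ W, ∃ b ∈ B.verts \ W,
      Relation.ReflTransGen ((ind R U).Adj ∅ W) u b) :
    B.verts = U ∧ B.edges = (ind R U).edges := by
  have key : ∀ W : Set (Stem R), W.Subsingleton → (ind R U).ConnectedAvoiding ∅ W := by
    intro W hW u hu v hv
    obtain ⟨b, hb, h1⟩ := h W hW u hu
    obtain ⟨c, hc, h2⟩ := h W hW v hv
    exact h1.trans ((rtg_mono (fun _ _ => adj_ind hU) (block_conn hB W hW b hb c hc)).trans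
      (rtg_symm adj_symm h2))
  refine hB.2.2 (ind R U) ⟨hB.1.1.mono hU, key _ Set.subsingleton_empty⟩ ?_ hU ?_
  · rintro w ⟨-, hw⟩
    exact hw (key _ Set.subsingleton_singleton)
  · intro e he v hv
    exact hU (B.ends_mem e he v hv)

theorem block_edges {R : RNA n} {B : Multigraph.Subgraph R.dualGraph} (hB : B.IsBlock)
    (e : DualEdge R) (h1 : e.src ∈ B.verts) (h2 : e.tgt ∈ B.verts) : e ∈ B.edges := by
  rw [(block_max hB B.verts le_rfl fun W _ u hu => ⟨u, hu, .refl⟩).2]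
  intro v hv
  rcases Sym2.mem_iff.1 hv with h | h <;> subst h <;> assumption

theorem ear_seq {R : RNA n} {B : Multigraph.Subgraph R.dualGraph} (hB : B.IsBlock)
    (f : ℕ → Stem R) (m : ℕ) (hm : 2 ≤ m) (h0 : f 0 ∈ B.verts) (h1 : f m ∈ B.verts)
    (hint : ∀ t, 0 < t → t < m → f t ∉ B.verts)
    (hadj : ∀ t < m, GA R (f t) (f (t+1)))
    (inj : ∀ s t, s ≤ m → t ≤ m → f s = f t → s = t) : False := by
  have hf : ∀ t ≤ m, f t ∈ B.verts ∪ {x | ∃ t ≤ m, f t = x} := fun t ht => Or.inr ⟨t, ht, rfl⟩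
  have := (block_max hB (B.verts ∪ {x | ∃ t ≤ m, f t = x}) Set.subset_union_left ?_).1
  · exact hint 1 (by omega) (by omega) (this ▸ hf 1 (by omega))
  · rintro W hW u ⟨hu | ⟨t, ht, rfl⟩, huW⟩
    · exact ⟨u, ⟨hu, huW⟩, .refl⟩
    · by_cases hb : ∃ s ≤ t, f s ∈ W
      · obtain ⟨s, hs, hsW⟩ := hb
        have hfw : ∀ s', t ≤ s' → s' ≤ m → f s' ∉ W := by
          intro s' h2 h3 h4
          have := inj _ _ (by omega) h3 (hW hsW h4)
          have : s = t := by omega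
          exact huW (this ▸ hsW)
        refine ⟨f m, ⟨h1, hfw m ht le_rfl⟩, ?_⟩
        have : ∀ d, t + d ≤ m → Relation.ReflTransGen
            ((ind R (B.verts ∪ {x | ∃ t ≤ m, f t = x})).Adj ∅ W) (f t) (f (t + d)) := by
          intro d
          induction d with
          | zero => intro _; exact .refl
          | succ d ih =>
            intro hd
            exact (ih (by omega)).tail (ind_adj (hf _ (by omega)) (hf _ (by omega))
              (hfw _ (by omega) (by omega)) (hfw _ (by omega) (by omega)) (hadj _ (by omega)))
        have := this (m - t) (by omega)
        rwa [show t + (m - t) = m by omega] at this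
      · push Not at hb
        refine ⟨f 0, ⟨h0, hb 0 (by omega)⟩, rtg_symm adj_symm ?_⟩
        have : ∀ d ≤ t, Relation.ReflTransGen
            ((ind R (B.verts ∪ {x | ∃ t ≤ m, f t = x})).Adj ∅ W) (f 0) (f d) := by
          intro d
          induction d with
          | zero => intro _; exact .refl
          | succ d ih =>
            intro hd
            exact (ih (by omega)).tail (ind_adj (hf _ (by omega)) (hf _ (by omega))
              (hb _ (by omega)) (hb _ (by omega)) (hadj _ (by omega)))
        exact this t le_rfl

/-- the graph outside the block -/
def outG (R : RNA n) (B : Multigraph.Subgraph R.dualGraph) : SimpleGraph (Stem R) where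
  Adj a b := a ≠ b ∧ a ∉ B.verts ∧ b ∉ B.verts ∧ GA R a b
  symm := ⟨fun _ _ h => ⟨h.1.symm, h.2.2.1, h.2.1, h.2.2.2.symm⟩⟩
  loopless := ⟨fun _ h => h.1 rfl⟩

/-- `X` is reachable from `v` via vertices outside the block -/
def Out (R : RNA n) (B : Multigraph.Subgraph R.dualGraph) (v X : Stem R) : Prop :=
  ∃ x, x ∉ B.verts ∧ GA R v x ∧ (outG R B).Reachable x X

theorem ear {R : RNA n} {B : Multigraph.Subgraph R.dualGraph} (hB : B.IsBlock)
    {v w x y : Stem R} (hv : v ∈ B.verts) (hw : w ∈ B.verts) (hvw : v ≠ w)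
    (hx : x ∉ B.verts) (hvx : GA R v x) (hxy : (outG R B).Reachable x y)
    (hyw : GA R y w) : False := by
  classical
  obtain ⟨p, hp⟩ := hxy.exists_isPath
  have hout : ∀ t ≤ p.length, p.getVert t ∉ B.verts := by
    intro t ht
    rcases Nat.eq_zero_or_pos t with rfl | h0
    · simpa using hx
    · have := p.adj_getVert_succ (i := t - 1) (by omega)
      rw [show t - 1 + 1 = t by omega] at this
      exact this.2.2.1
  let f : ℕ → Stem R := fun t => if t = 0 then v else if t ≤ p.length + 1 then p.getVert (t-1) else w
  have f0 : f 0 = v := by simp [f]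
  have fm : f (p.length + 2) = w := by simp [f]
  have fi : ∀ t, 0 < t → t < p.length + 2 → f t = p.getVert (t - 1) := by
    intro t h1 h2
    simp only [f]
    rw [if_neg (by omega), if_pos (by omega)]
  have fB : ∀ t, 0 < t → t < p.length + 2 → f t ∉ B.verts := by
    intro t h1 h2
    rw [fi t h1 h2]
    exact hout _ (by omega)
  refine ear_seq hB f (p.length + 2) (by omega) (f0 ▸ hv) (fm ▸ hw) fB ?_ ?_
  · intro t ht
    rcases Nat.eq_zero_or_pos t with rfl | h0
    · rw [f0, fi _ (by omega) (by omega)]; simpa using hvx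
    · rcases Nat.lt_or_ge t (p.length + 1) with h1 | h1
      · rw [fi _ (by omega) (by omega), fi _ (by omega) (by omega)]
        have := p.adj_getVert_succ (i := t - 1) (by omega)
        rw [show t - 1 + 1 = t by omega] at this
        rw [show t + 1 - 1 = t by omega]
        exact this.2.2.2
      · have : t = p.length + 1 := by omega
        subst this
        rw [fm, fi _ (by omega) (by omega)]
        simpa using hyw
  · have : ∀ s t, s < t → t ≤ p.length + 2 → f s ≠ f t := by
      intro s t hst ht heq
      by_cases hs : s = 0
      · subst hs
        by_cases ht' : t = p.length + 2
        · subst ht'; rw [f0, fm] at heq; exact hvw heq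
        · apply fB t (by omega) (by omega)
          rw [← heq, f0]; exact hv
      · by_cases ht' : t = p.length + 2
        · subst ht'
          apply fB s (by omega) (by omega)
          rw [heq, fm]; exact hw
        · rw [fi _ (by omega) (by omega), fi _ (by omega) (by omega)] at heq
          have := hp.getVert_injOn (by simp; omega) (by simp; omega) heq
          omega
    intro s t hs ht heq
    rcases lt_trichotomy s t with h | h | h
    · exact absurd heq (this s t h ht)
    · exact h
    · exact absurd heq.symm (this t s h hs)

theorem ear_out {R : RNA n} {B : Multigraph.Subgraph R.dualGraph} (hB : B.IsBlock)
    {v w X : Stem R} (hv : v ∈ B.verts) (hw : w ∈ B.verts)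
    (h1 : Out R B v X) (h2 : Out R B w X) : v = w := by
  obtain ⟨x, hx, hvx, hxX⟩ := h1
  obtain ⟨y, hy, hwy, hyX⟩ := h2
  by_contra hne
  exact ear hB hv hw hne hx hvx (hxX.trans hyX.symm) hwy.symm

theorem prev_paired {R : RNA n} {a b : ℕ} (ha : R.Paired a) (hb : R.Paired b) (hab : a < b) :
    ∃ c, a ≤ c ∧ R.IsSegment c b := by
  classical
  have hs : (a : ℕ) ≤ b - 1 := by omega
  refine ⟨Nat.findGreatest R.Paired (b - 1), Nat.le_findGreatest hs ha, ?_, ?_, hb, ?_⟩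
  · have := Nat.findGreatest_le (P := R.Paired) (b - 1); omega
  · exact Nat.findGreatest_spec hs ha
  · intro t h1 h2
    exact Nat.findGreatest_is_greatest h1 (by omega)

theorem ga_of_seg {R : RNA n} {c b : ℕ} {S T : Stem R} (h : R.IsSegment c b) (hS : S.MemPos c)
    (hT : T.MemPos b) (hne : S ≠ T) : GA R S T := ⟨⟨c, b, S, T, h, hS, hT, hne⟩, rfl⟩

theorem left_lemma {R : RNA n} {B : Multigraph.Subgraph R.dualGraph} {a₀ : ℕ} {S₀ : Stem R}
    (hS₀ : S₀ ∈ B.verts) (ha₀ : S₀.MemPos a₀) (d : ℕ) : ∀ (X : Stem R) (_ : X ∉ B.verts)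
    (_ : X.MemPos d) (_ : a₀ < d), ∃ a, ∃ S ∈ B.verts, S.MemPos a ∧ a < d ∧ a₀ ≤ a ∧ Out R B S X ∧
      ∀ T ∈ B.verts, ∀ t, T.MemPos t → t ≤ d → t ≤ a := by
  induction d using Nat.strong_induction_on with
  | _ d ih =>
    intro X hX hd had
    obtain ⟨c, hac, hseg⟩ := prev_paired ha₀.paired hd.paired had
    obtain ⟨Y, hY⟩ := R.exists_stem hseg.2.1
    have hcd := hseg.1
    have hmax : ∀ T ∈ B.verts, ∀ t, T.MemPos t → t ≤ d → t ≤ c := by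
      intro T hT t ht htd
      by_contra hlt
      rcases Nat.lt_or_ge t d with h | h
      · exact hseg.2.2.2 t (by omega) h ht.paired
      · have : t = d := by omega
        subst this
        exact hX (stem_unique hd ht ▸ hT)
    by_cases hYB : Y ∈ B.verts
    · refine ⟨c, Y, hYB, hY, hcd, hac, ⟨X, hX, ga_of_seg hseg hY hd ?_, .refl _⟩, hmax⟩
      rintro rfl; exact hX hYB
    · have hne : a₀ ≠ c := by
        rintro rfl; exact hYB (stem_unique ha₀ hY ▸ hS₀)
      obtain ⟨a, S, hS, hSa, hlt, hle, ⟨x, hx, hSx, hr⟩, hm⟩ := ih c hcd Y hYB hY (by omega)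
      refine ⟨a, S, hS, hSa, by omega, hle, ⟨x, hx, hSx, ?_⟩,
        fun T hT t ht htd => hm T hT t ht (hmax T hT t ht htd)⟩
      by_cases hYX : Y = X
      · exact hYX ▸ hr
      · exact hr.trans (SimpleGraph.Adj.reachable ⟨hYX, hYB, hX, ga_of_seg hseg hY hd hYX⟩)

theorem walk_lemma {R : RNA n} {B : Multigraph.Subgraph R.dualGraph} (hB : B.IsBlock)
    {a : ℕ} {S : Stem R} (hS : S ∈ B.verts) (ha : S.MemPos a) (F : Set (DualEdge R)) (b : ℕ) :
    ∀ (T : Stem R) (_ : T ∈ B.verts) (_ : T.MemPos b) (_ : a ≤ b)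
      (_ : ∀ e ∈ F, e.p < a ∨ b < e.q),
      Relation.ReflTransGen (B.Adj F ∅) S T := by
  induction b using Nat.strong_induction_on with
  | _ b ih =>
    intro T hT hb hab hF
    rcases Nat.eq_or_lt_of_le hab with rfl | hlt
    · rw [stem_unique ha hb]
    · obtain ⟨c, hac, hseg⟩ := prev_paired ha.paired hb.paired hlt
      obtain ⟨Y, hY⟩ := R.exists_stem hseg.2.1
      have hcd := hseg.1
      by_cases hYB : Y ∈ B.verts
      · have h1 := ih c hcd Y hYB hY hac (fun e he => (hF e he).imp id (by omega))
        by_cases hYT : Y = T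
        · exact hYT ▸ h1
        · refine h1.tail ⟨hYB, hT, by simp, by simp, ⟨c, b, Y, T, hseg, hY, hb, hYT⟩,
            block_edges hB _ hYB hT, ?_, rfl⟩
          intro he
          have := hF _ he
          simp only at this
          omega
      · have hne : a ≠ c := by
          rintro rfl; exact hYB (stem_unique ha hY ▸ hS)
        obtain ⟨a', S', hS', hSa', hlt', hle', ⟨x, hx, hSx, hr⟩, hm⟩ :=
          left_lemma hS ha c Y hYB hY (by omega)
        have hST : S' = T := by
          by_contra hne
          refine ear hB hS' hT hne hx hSx hr (ga_of_seg hseg hY hb ?_)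
          rintro rfl; exact hYB hT
        subst hST
        exact ih a' (by omega) S' hT hSa' hle' (fun e he => (hF e he).imp id (by omega))

theorem reconnect {R : RNA n} {B : Multigraph.Subgraph R.dualGraph} {e f : DualEdge R}
    (hc : B.ConnectedAvoiding {f} ∅)
    (h : Relation.ReflTransGen (B.Adj {e, f} ∅) e.src e.tgt) :
    B.ConnectedAvoiding {e, f} ∅ := by
  intro u hu v hv
  have := hc u hu v hv
  induction this with
  | refl => exact .refl
  | @tail b c hb hbc ih =>
    obtain ⟨h1, h2, h3, h4, g, hg, hgF, hh⟩ := hbc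
    refine (ih ⟨h1, h3⟩).trans ?_
    by_cases hge : g = e
    · subst hge
      have hh : s(g.src, g.tgt) = s(b, c) := hh
      rcases Sym2.eq_iff.1 hh with ⟨h5, h6⟩ | ⟨h5, h6⟩
      · rw [h5, h6] at h; exact h
      · rw [h5, h6] at h; exact rtg_symm adj_symm h
    · exact .single ⟨h1, h2, h3, h4, g, hg, by simp [hge]; simpa using hgF, hh⟩

theorem edge_ext {R : RNA n} {e f : DualEdge R} (h : e.p = f.p) : e = f := by
  have hq : e.q = f.q := by
    have h1 := e.seg
    have h2 := f.seg
    rcases lt_trichotomy e.q f.q with h' | h' | h'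
    · exact absurd h1.2.2.1 (h2.2.2.2 _ (by have := h1.1; omega) h')
    · exact h'
    · exact absurd h2.2.2.1 (h1.2.2.2 _ (by have := h2.1; omega) h')
  have hs : e.src = f.src := stem_unique e.mem_src (h ▸ f.mem_src)
  have ht : e.tgt = f.tgt := stem_unique e.mem_tgt (hq ▸ f.mem_tgt)
  cases e; cases f; simp at *; simp [*]

theorem main_aux {R : RNA n} (B : Multigraph.Subgraph R.dualGraph) (hB : B.IsBlock)
    (i j : ℕ)
    (hi : ∃ S ∈ B.verts, S.MemPos i)
    (hspan : ∀ S ∈ B.verts, ∀ p : ℕ, S.MemPos p → i ≤ p ∧ p ≤ j)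
    (hc : ∀ e, B.ConnectedAvoiding {e} ∅) (e f : DualEdge R) (he : e ∈ B.edges) (hf : f ∈ B.edges)
    (hef : e.p < f.p) (hd : ¬ B.ConnectedAvoiding {e, f} ∅) : R.RecursivePK i j := by
  have es := B.ends_mem e he e.src (Sym2.mem_mk_left _ _)
  have et := B.ends_mem e he e.tgt (Sym2.mem_mk_right _ _)
  have fs := B.ends_mem f hf f.src (Sym2.mem_mk_left _ _)
  have ft := B.ends_mem f hf f.tgt (Sym2.mem_mk_right _ _)
  have e1 := e.seg.1
  have f1 := f.seg.1
  have hkl : e.q ≤ f.p := by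
    by_contra h
    exact e.seg.2.2.2 f.p hef (by omega) f.seg.2.1
  have caseB : ∀ v ∈ B.verts, ∀ d c, v.MemPos d → v.MemPos c → e.q ≤ d → d ≤ f.p →
      e.q ≤ c ∧ c ≤ f.p := by
    intro v hv d c hvd hvc h1 h2
    by_contra hcon
    rcases Nat.lt_or_ge c e.q with h | h
    · have hce : c ≤ e.p := by
        by_contra h'
        exact e.seg.2.2.2 c (by omega) h hvc.paired
      have w1 := walk_lemma hB hv hvc {e, f} e.p e.src es e.mem_src hce (by
        rintro g (rfl | rfl) <;> omega)
      have w2 := walk_lemma hB et e.mem_tgt {e, f} d v hv hvd h1 (by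
        rintro g (rfl | rfl) <;> omega)
      exact hd (reconnect (hc f) (rtg_symm adj_symm (w2.trans w1)))
    · have hce : f.q ≤ c := by
        by_contra h'
        exact f.seg.2.2.2 c (by omega) (by omega) hvc.paired
      have w1 := walk_lemma hB ft f.mem_tgt {f, e} c v hv hvc hce (by
        rintro g (rfl | rfl) <;> omega)
      have w2 := walk_lemma hB hv hvd {f, e} f.p f.src fs f.mem_src h2 (by
        rintro g (rfl | rfl) <;> omega)
      have := reconnect (hc e) (rtg_symm adj_symm (w1.trans w2))
      rw [Set.pair_comm] at this
      exact hd this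
  have ⟨a, b, hab, ha, hb⟩ : ∃ a b, (a, b) ∈ R.pairs ∧ e.tgt.MemPos a ∧ e.tgt.MemPos b :=
    ⟨_, _, e.tgt.nested 0 (by omega), ⟨0, by omega, Or.inl rfl⟩, ⟨0, by omega, Or.inr rfl⟩⟩
  have ca := caseB _ et _ _ e.mem_tgt ha le_rfl hkl
  have cb := caseB _ et _ _ e.mem_tgt hb le_rfl hkl
  have hablt : a < b := R.fst_lt_snd _ hab
  have q1 := hspan _ es _ e.mem_src
  have q2 := hspan _ ft _ f.mem_tgt
  refine ⟨e.q, f.p, by omega, by omega, by omega, ⟨a, b, hab, by omega, by omega⟩, ?_⟩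
  intro c d hcd h1 h2 h3 h4
  obtain ⟨X, hXc, hXd⟩ : ∃ X : Stem R, X.MemPos c ∧ X.MemPos d := by
    rcases hcd with h | h
    · exact R.exists_stem_pair h
    · obtain ⟨X, h, h'⟩ := R.exists_stem_pair h
      exact ⟨X, h', h⟩
  by_cases hX : X ∈ B.verts
  · exact caseB X hX d c hXd hXc h1 h2
  by_contra hcon
  have hne : ∀ T ∈ B.verts, ∀ t, T.MemPos t → t ≠ c ∧ t ≠ d := by
    intro T hT t ht
    constructor
    · rintro rfl; exact hX (stem_unique hXc ht ▸ hT)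
    · rintro rfl; exact hX (stem_unique hXd ht ▸ hT)
  have n1 := hne _ et _ e.mem_tgt
  obtain ⟨a₁, S₁, hS₁, m₁, l₁, g₁, o₁, -⟩ := left_lemma et e.mem_tgt d X hX hXd (by omega)
  obtain ⟨I, hI, mI⟩ := hi
  have n2 := hne _ hI _ mI
  obtain ⟨a₂, S₂, hS₂, m₂, l₂, g₂, o₂, x₂⟩ := left_lemma hI mI c X hX hXc (by omega)
  have := ear_out hB hS₁ hS₂ o₁ o₂
  subst this
  have := caseB S₁ hS₁ a₁ a₂ m₁ m₂ g₁ (by omega)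
  rcases Nat.lt_or_ge c e.q with h | h
  · omega
  · have : f.q ≤ c := by
      by_contra h'
      exact f.seg.2.2.2 c (by omega) (by omega) hXc.paired
    have := x₂ _ ft _ f.mem_tgt this
    omega

end RNA



/-- Let `B` be a block of the dual graph of an RNA secondary
structure representing a pseudoknot (some vertex of `B` has degree at least
3), and let `[i, j]` be the region of the primary sequence spanned by the
stems of `B`.  If `B` has edge-connectivity exactly 2, then the pseudoknot is
recursive. -/
theorem block_with_edge_connectivity_two_is_recursive {n : ℕ}
    (R : RNA n) (B : Multigraph.Subgraph R.dualGraph) (hB : B.IsBlock)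
    (hPK : ∃ u ∈ B.verts, 3 ≤ B.degree u)
    (i j : ℕ)
    (hi : ∃ S ∈ B.verts, S.MemPos i) (hj : ∃ S ∈ B.verts, S.MemPos j)
    (hspan : ∀ S ∈ B.verts, ∀ p : ℕ, S.MemPos p → i ≤ p ∧ p ≤ j)
    (hconn : B.EdgeConnTwo) :
    R.RecursivePK i j := by
  obtain ⟨-, hc, e, he, f, hf, hne, hd⟩ := hconn
  rcases lt_trichotomy e.p f.p with h | h | h
  · exact RNA.main_aux B hB i j hi hspan hc e f he hf h hd
  · exact absurd (RNA.edge_ext h) hne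
  · exact RNA.main_aux B hB i j hi hspan hc f e hf he h (by rwa [Set.pair_comm])
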